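/- Let V be a complex vector space of dimension 2n with a nondegenerate symmetric bilinear form B, and let W₁ and W₂ be maximal isotropic subspaces of V such that dim(W₁ ∩ W₂) ≡ n (mod 2). Then there exists a maximal isotropic subspace H of V that is simultaneously a complement of both: V = W₁ ⊕ H and V = W₂ ⊕ H. -/

import Mathlib

/-- A subspace `W` is isotropic for `B`. -/
def IsIsotropic {R V : Type*} [CommRing R] [AddCommGroup V] [Module R V]
    (B : V →ₗ[R] V →ₗ[R] R) (W : Submodule R V) : Prop :=
  ∀ w ∈ W, ∀ w' ∈ W, B w w' = 0

/-- A subspace `W` is maximal isotropic for `B`: it is isotropic and not properly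
contained in any other isotropic subspace. -/
def IsMaxIsotropic {R V : Type*} [CommRing R] [AddCommGroup V] [Module R V]
    (B : V →ₗ[R] V →ₗ[R] R) (W : Submodule R V) : Prop :=
  IsIsotropic B W ∧ ∀ W' : Submodule R V, IsIsotropic B W' → W ≤ W' → W' = W

open Module

section

variable {K V : Type*} [Field K] [AddCommGroup V] [Module K V]

/-- An isotropic vector orthogonal to a maximal isotropic subspace lies in it. -/
lemma IsMaxIsotropic.mem_of_isotropic_of_orthogonal {B : V →ₗ[K] V →ₗ[K] K}
    (hsymm : ∀ x y, B x y = B y x) {W : Submodule K V} (hW : IsMaxIsotropic B W) {x : V}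
    (hx : ∀ w ∈ W, B w x = 0) (hxx : B x x = 0) : x ∈ W := by
  have key : W ⊔ K ∙ x = W := by
    refine hW.2 _ ?_ le_sup_left
    intro a ha b hb
    obtain ⟨w, hw, u, hu, rfl⟩ := Submodule.mem_sup.1 ha
    obtain ⟨w', hw', u', hu', rfl⟩ := Submodule.mem_sup.1 hb
    obtain ⟨c, rfl⟩ := Submodule.mem_span_singleton.1 hu
    obtain ⟨c', rfl⟩ := Submodule.mem_span_singleton.1 hu'
    simp [hW.1 w hw w' hw', hx w hw, hsymm x w', hx w' hw', hxx]
  rw [← key]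
  exact Submodule.mem_sup_right (Submodule.mem_span_singleton_self x)

lemma nondegenerate_of_symm {B : V →ₗ[K] V →ₗ[K] K} (hsymm : ∀ x y, B x y = B y x)
    (hnondeg : ∀ x, (∀ y, B x y = 0) → x = 0) : B.Nondegenerate :=
  ⟨hnondeg, fun x h => hnondeg x fun y => (hsymm x y).trans (h y)⟩

/-- Over an algebraically closed field, a maximal isotropic subspace of an even-dimensional
space contains every vector orthogonal to it. -/
lemma IsMaxIsotropic.mem_of_orthogonal [IsAlgClosed K] [NeZero (2 : K)] [FiniteDimensional K V]
    {n : ℕ} (hdim : finrank K V = 2 * n) {B : V →ₗ[K] V →ₗ[K] K}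
    (hsymm : ∀ x y, B x y = B y x) (hnondeg : ∀ x, (∀ y, B x y = 0) → x = 0)
    {W : Submodule K V} (hW : IsMaxIsotropic B W) {x : V} (hx : ∀ w ∈ W, B w x = 0) :
    x ∈ W := by
  by_contra hxW
  have hxx : B x x ≠ 0 := fun h => hxW (hW.mem_of_isotropic_of_orthogonal hsymm hx h)
  have hx0 : x ≠ 0 := by rintro rfl; exact hxW W.zero_mem
  have hxP : x ∈ LinearMap.BilinForm.orthogonal B W := hx
  have hWP : W ≤ LinearMap.BilinForm.orthogonal B W := fun w hw w' hw' => hW.1 w' hw' w hw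
  have hle : W ⊔ K ∙ x ≤ LinearMap.BilinForm.orthogonal B W :=
    sup_le hWP ((Submodule.span_singleton_le_iff_mem _ _).2 hxP)
  have hdisj : W ⊓ K ∙ x = ⊥ := ((Submodule.disjoint_span_singleton' hx0).2 hxW).eq_bot
  have hsup := Submodule.finrank_sup_add_finrank_inf_eq W (K ∙ x)
  rw [hdisj, finrank_bot, finrank_span_singleton hx0] at hsup
  have horth := LinearMap.BilinForm.finrank_orthogonal (nondegenerate_of_symm hsymm hnondeg) W
  have hWV := Submodule.finrank_le W
  have hne : W ⊔ K ∙ x ≠ LinearMap.BilinForm.orthogonal B W := by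
    intro h
    rw [h] at hsup
    omega
  obtain ⟨y, hyP, hy⟩ := SetLike.exists_of_lt (lt_of_le_of_ne hle hne)
  obtain ⟨s, hs⟩ := IsAlgClosed.exists_eq_mul_self (discrim (B x x) (2 * B x y) (B y y))
  obtain ⟨c, hc⟩ := exists_quadratic_eq_zero hxx ⟨s, hs⟩
  have hz : c • x + y ∈ W := by
    refine hW.mem_of_isotropic_of_orthogonal hsymm (fun w hw => ?_) ?_
    · have h : B w y = 0 := hyP w hw
      simp [hx w hw, h]
    · simp only [map_add, map_smul, LinearMap.add_apply, LinearMap.smul_apply, smul_eq_mul,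
        hsymm y x]
      linear_combination hc
  apply hy
  have : y = (c • x + y) + (-c) • x := by module
  rw [this]
  exact Submodule.add_mem_sup hz (Submodule.smul_mem _ _ (Submodule.mem_span_singleton_self x))

lemma IsMaxIsotropic.finrank_eq [IsAlgClosed K] [NeZero (2 : K)] [FiniteDimensional K V]
    {n : ℕ} (hdim : finrank K V = 2 * n) {B : V →ₗ[K] V →ₗ[K] K}
    (hsymm : ∀ x y, B x y = B y x) (hnondeg : ∀ x, (∀ y, B x y = 0) → x = 0)
    {W : Submodule K V} (hW : IsMaxIsotropic B W) : finrank K W = n := by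
  have h : LinearMap.BilinForm.orthogonal B W = W :=
    le_antisymm (fun x hx => hW.mem_of_orthogonal hdim hsymm hnondeg hx)
      fun w hw w' hw' => hW.1 w' hw' w hw
  have horth := LinearMap.BilinForm.finrank_orthogonal (nondegenerate_of_symm hsymm hnondeg) W
  have hWV := Submodule.finrank_le W
  rw [h] at horth
  omega

/-- An isotropic complement of an isotropic subspace is maximal isotropic. -/
lemma IsIsotropic.isMaxIsotropic_of_isCompl {B : V →ₗ[K] V →ₗ[K] K}
    (hnondeg : ∀ x, (∀ y, B x y = 0) → x = 0) {W H : Submodule K V}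
    (hW : IsIsotropic B W) (hH : IsIsotropic B H) (hc : IsCompl W H) : IsMaxIsotropic B H := by
  refine ⟨hH, fun H' hH' hle => le_antisymm (fun x hx => ?_) hle⟩
  have exists_add (v : V) : ∃ w ∈ W, ∃ h ∈ H, w + h = v :=
    Submodule.mem_sup.1 (hc.sup_eq_top ▸ Submodule.mem_top)
  obtain ⟨w, hw, h, hh, rfl⟩ := exists_add x
  have hwH' : w ∈ H' := by simpa using H'.sub_mem hx (hle hh)
  have hw0 : w = 0 := by
    refine hnondeg w fun y => ?_
    obtain ⟨w', hw', h', hh', rfl⟩ := exists_add y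
    simp [hW w hw w' hw', hH' w hwH' h' (hle hh')]
  simpa [hw0] using hh

/-- An even-dimensional space carries a nondegenerate alternating form. -/
lemma exists_alternating_injective {X : Type*} [AddCommGroup X] [Module K X]
    [FiniteDimensional K X] (heven : Even (finrank K X)) :
    ∃ ω : X →ₗ[K] Dual K X, (∀ x y, ω x y + ω y x = 0) ∧ Function.Injective ω := by
  obtain ⟨r, hr⟩ := heven
  have e : X ≃ₗ[K] (Fin r → K) × (Fin r → K) := LinearEquiv.ofFinrankEq _ _ (by simp [hr])
  let p : X →ₗ[K] (Fin r → K) := LinearMap.fst K _ _ ∘ₗ e.toLinearMap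
  let q : X →ₗ[K] (Fin r → K) := LinearMap.snd K _ _ ∘ₗ e.toLinearMap
  let dot := dotProductBilin (m := Fin r) (A := K) K K
  refine ⟨dot.compl₁₂ p q - dot.compl₁₂ q p, fun x y => ?_, ?_⟩
  · simp [dot, dotProduct_comm]
  · rw [injective_iff_map_eq_zero]
    intro x hx
    have h (y) : (e x).1 ⬝ᵥ (e y).2 - (e x).2 ⬝ᵥ (e y).1 = 0 := LinearMap.congr_fun hx y
    have h1 : (e x).1 = 0 := dotProduct_eq_zero _ fun v => by simpa using h (e.symm (0, v))
    have h2 : (e x).2 = 0 := dotProduct_eq_zero _ fun v => by simpa using h (e.symm (v, 0))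
    exact e.map_eq_zero_iff.1 (Prod.ext h1 h2)

/-- The dual of an isotropic subspace `D` lifts to an isotropic family of vectors orthogonal to any
given subspace `U` that is disjoint from and orthogonal to `D`. -/
lemma IsIsotropic.exists_isotropic_dual_lift [NeZero (2 : K)] [FiniteDimensional K V]
    {B : V →ₗ[K] V →ₗ[K] K}
    (hsymm : ∀ x y, B x y = B y x) (hnondeg : ∀ x, (∀ y, B x y = 0) → x = 0)
    {D U : Submodule K V} (hD : IsIsotropic B D) (hdisj : Disjoint D U)
    (hDU : ∀ d ∈ D, ∀ u ∈ U, B d u = 0) :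
    ∃ F : Dual K D →ₗ[K] V, (∀ ξ (d : D), B (F ξ) d = ξ d) ∧ (∀ ξ, ∀ u ∈ U, B (F ξ) u = 0) ∧
      ∀ ξ η, B (F ξ) (F η) = 0 := by
  obtain ⟨C, hUC, hC⟩ := hdisj.symm.exists_isCompl
  let P : Dual K D →ₗ[K] V :=
    (LinearMap.BilinForm.toDual B (nondegenerate_of_symm hsymm hnondeg)).symm.toLinearMap ∘ₗ
      (D.projectionOnto C hC.symm).dualMap
  have hP (ξ v) : B (P ξ) v = ξ (D.projectionOnto C hC.symm v) :=
    LinearMap.BilinForm.apply_toDual_symm_apply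
      (hB := nondegenerate_of_symm hsymm hnondeg) _ v
  let S : Dual K D →ₗ[K] D :=
    (evalEquiv K D).symm.toLinearMap ∘ₗ B.compl₁₂ P P
  have hS (ξ η : Dual K D) : η (S ξ) = B (P ξ) (P η) := by simp [S]
  have hPD (ξ) (d : D) : B (P ξ) d = ξ d := by rw [hP, Submodule.projectionOnto_apply_left]
  have two : (2 : K) ≠ 0 := NeZero.ne 2
  refine ⟨P - (2⁻¹ : K) • (D.subtype ∘ₗ S), fun ξ d => ?_, fun ξ u hu => ?_, fun ξ η => ?_⟩
  · have : B (S ξ) d = 0 := hD _ (S ξ).2 _ d.2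
    simp [hPD, this]
  · have : D.projectionOnto C hC.symm u = 0 :=
      (Submodule.projectionOnto_apply_eq_zero_iff hC.symm).2 (hUC hu)
    simp [hP, this, hDU _ (S ξ).2 u hu]
  · have hSS : B (S ξ) (S η) = 0 := hD _ (S ξ).2 _ (S η).2
    simp only [LinearMap.sub_apply, LinearMap.smul_apply, LinearMap.comp_apply,
      Submodule.subtype_apply, map_sub, map_smul, smul_eq_mul, hPD, hsymm (S ξ) (P η), hS,
      hsymm (P η) (P ξ), hSS]
    field_simp
    ring

/-- Complements of `W₁ ⊓ W₂` in two Lagrangian subspaces `W₁` and `W₂` are in duality. -/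
lemma exists_dual_equiv_of_lagrangian [FiniteDimensional K V] {B : V →ₗ[K] V →ₗ[K] K}
    {W₁ W₂ U₁ U₂ : Submodule K V} (hW₁ : IsIsotropic B W₁)
    (hW₂ : ∀ x, (∀ w ∈ W₂, B w x = 0) → x ∈ W₂) (hsymm : ∀ x y, B x y = B y x)
    (hfin : finrank K W₁ = finrank K W₂)
    (hd₁ : Disjoint (W₁ ⊓ W₂) U₁) (hs₁ : W₁ ⊓ W₂ ⊔ U₁ = W₁)
    (hd₂ : Disjoint (W₁ ⊓ W₂) U₂) (hs₂ : W₁ ⊓ W₂ ⊔ U₂ = W₂) :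
    ∃ φ : U₂ ≃ₗ[K] Dual K U₁, ∀ (u₁ : U₁) (u₂ : U₂), φ u₂ u₁ = B u₁ u₂ := by
  have hU₁ : U₁ ≤ W₁ := hs₁ ▸ le_sup_right
  have f₁ := Submodule.finrank_sup_add_finrank_inf_eq (W₁ ⊓ W₂) U₁
  have f₂ := Submodule.finrank_sup_add_finrank_inf_eq (W₁ ⊓ W₂) U₂
  rw [hs₁, hd₁.eq_bot, finrank_bot] at f₁
  rw [hs₂, hd₂.eq_bot, finrank_bot] at f₂
  let ψ : U₁ →ₗ[K] Dual K U₂ := B.compl₁₂ U₁.subtype U₂.subtype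
  have hψ : Function.Injective ψ := by
    rw [injective_iff_map_eq_zero]
    intro u hu
    have huW₂ : (u : V) ∈ W₂ := by
      refine hW₂ _ fun w hw => ?_
      rw [← hs₂] at hw
      obtain ⟨d, hd, v, hv, rfl⟩ := Submodule.mem_sup.1 hw
      have h : B u v = 0 := LinearMap.congr_fun hu ⟨v, hv⟩
      simp [hW₁ d hd.1 u (hU₁ u.2), hsymm v, h]
    exact Subtype.ext (Submodule.disjoint_def.1 hd₁ _ ⟨hU₁ u.2, huW₂⟩ u.2)
  let e : U₁ ≃ₗ[K] Dual K U₂ := ψ.linearEquivOfInjective hψ (by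
    rw [Subspace.dual_finrank_eq]
    omega)
  exact ⟨(evalEquiv K U₂).trans e.dualMap, fun u₁ u₂ => rfl⟩

/-- Two Lagrangian subspaces whose intersection has even codimension in them have a common
isotropic complement. -/
lemma exists_isIsotropic_isCompl_of_lagrangian [NeZero (2 : K)] [FiniteDimensional K V]
    {n : ℕ} (hdim : finrank K V = 2 * n) {B : V →ₗ[K] V →ₗ[K] K}
    (hsymm : ∀ x y, B x y = B y x) (hnondeg : ∀ x, (∀ y, B x y = 0) → x = 0)
    {W₁ W₂ : Submodule K V} (hW₁ : IsIsotropic B W₁) (hW₂ : IsIsotropic B W₂)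
    (hL₂ : ∀ x, (∀ w ∈ W₂, B w x = 0) → x ∈ W₂)
    (hn₁ : finrank K W₁ = n) (hn₂ : finrank K W₂ = n)
    (hpar : finrank K (W₁ ⊓ W₂ : Submodule K V) % 2 = n % 2) :
    ∃ H : Submodule K V, IsIsotropic B H ∧ IsCompl W₁ H ∧ IsCompl W₂ H := by
  obtain ⟨U₁, hd₁, hs₁⟩ :=
    IsModularLattice.exists_disjoint_and_sup_eq (inf_le_left : W₁ ⊓ W₂ ≤ W₁)
  obtain ⟨U₂, hd₂, hs₂⟩ :=
    IsModularLattice.exists_disjoint_and_sup_eq (inf_le_right : W₁ ⊓ W₂ ≤ W₂)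
  have hU₁ : U₁ ≤ W₁ := hs₁ ▸ le_sup_right
  have hU₂ : U₂ ≤ W₂ := hs₂ ▸ le_sup_right
  have zero₁ {u} (hu : u ∈ U₁) (h : u ∈ W₂) : u = 0 :=
    Submodule.disjoint_def.1 hd₁ u ⟨hU₁ hu, h⟩ hu
  have zero₂ {u} (hu : u ∈ U₂) (h : u ∈ W₁) : u = 0 :=
    Submodule.disjoint_def.1 hd₂ u ⟨h, hU₂ hu⟩ hu
  have hfin := Submodule.finrank_sup_add_finrank_inf_eq (W₁ ⊓ W₂) U₁
  rw [hs₁, hd₁.eq_bot, finrank_bot] at hfin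
  obtain ⟨φ, hφ⟩ := exists_dual_equiv_of_lagrangian hW₁ hL₂ hsymm (hn₁.trans hn₂.symm)
    hd₁ hs₁ hd₂ hs₂
  obtain ⟨ω, hω, hωinj⟩ := exists_alternating_injective (K := K) (X := U₁)
    (by rw [Nat.even_iff]; omega)
  let A : U₁ →ₗ[K] U₂ := φ.symm.toLinearMap ∘ₗ ω
  have hA (u v : U₁) : B u (A v) = ω v u := by simp [← hφ, A]
  have hAinj : Function.Injective A := φ.symm.injective.comp hωinj
  have hdisj : Disjoint (W₁ ⊓ W₂) (U₁ ⊔ U₂) := by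
    rw [Submodule.disjoint_def]
    intro d hd hdU
    obtain ⟨u₁, hu₁, u₂, hu₂, rfl⟩ := Submodule.mem_sup.1 hdU
    have h₁ : u₁ = 0 := zero₁ hu₁ ((Submodule.add_mem_iff_left _ (hU₂ hu₂)).1 hd.2)
    have h₂ : u₂ = 0 := zero₂ hu₂ ((Submodule.add_mem_iff_right _ (hU₁ hu₁)).1 hd.1)
    simp [h₁, h₂]
  have hDU : ∀ d ∈ W₁ ⊓ W₂, ∀ u ∈ U₁ ⊔ U₂, B d u = 0 := by
    intro d hd u hu
    obtain ⟨u₁, hu₁, u₂, hu₂, rfl⟩ := Submodule.mem_sup.1 hu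
    simp [hW₁ d hd.1 u₁ (hU₁ hu₁), hW₂ d hd.2 u₂ (hU₂ hu₂)]
  have hD : IsIsotropic B (W₁ ⊓ W₂) := fun x hx y hy => hW₁ x hx.1 y hy.1
  obtain ⟨F, hFD, hFU, hFF⟩ := hD.exists_isotropic_dual_lift hsymm hnondeg hdisj hDU
  let T : Dual K (W₁ ⊓ W₂ : Submodule K V) × U₁ →ₗ[K] V :=
    F.coprod (U₁.subtype + U₂.subtype ∘ₗ A)
  have hT (ξ u) : T (ξ, u) = F ξ + (u + A u) := by simp [T]
  have mem_U (u : U₁) : (u : V) + A u ∈ U₁ ⊔ U₂ := Submodule.add_mem_sup u.2 (A u).2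
  have eq_zero_of_orthogonal {ξ u} (h : ∀ d ∈ W₁ ⊓ W₂, B (T (ξ, u)) d = 0) : ξ = 0 := by
    ext d
    have := h d d.2
    rwa [hT, map_add, LinearMap.add_apply, hFD, hsymm _ (d : V), hDU d d.2 _ (mem_U u),
      add_zero] at this
  have eq_zero₁ {x} (h : T x ∈ W₁) : x = 0 := by
    obtain ⟨ξ, u⟩ := x
    obtain rfl : ξ = 0 := eq_zero_of_orthogonal fun d hd => hW₁ _ h d hd.1
    rw [hT, map_zero, zero_add, Submodule.add_mem_iff_right _ (hU₁ u.2)] at h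
    have : A u = 0 := Subtype.ext (zero₂ (A u).2 h)
    rw [(map_eq_zero_iff A hAinj).1 this, Prod.mk_zero_zero]
  have eq_zero₂ {x} (h : T x ∈ W₂) : x = 0 := by
    obtain ⟨ξ, u⟩ := x
    obtain rfl : ξ = 0 := eq_zero_of_orthogonal fun d hd => hW₂ _ h d hd.2
    rw [hT, map_zero, zero_add, Submodule.add_mem_iff_left _ (hU₂ (A u).2)] at h
    have : u = 0 := Subtype.ext (zero₁ u.2 h)
    rw [this, Prod.mk_zero_zero]
  have hTinj : Function.Injective T := by
    rw [injective_iff_map_eq_zero]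
    exact fun x hx => eq_zero₁ (hx ▸ W₁.zero_mem)
  have hfinT : finrank K T.range = n := by
    rw [LinearMap.finrank_range_of_inj hTinj, finrank_prod, Subspace.dual_finrank_eq]
    omega
  refine ⟨T.range, ?_, ?_, ?_⟩
  · rintro _ ⟨⟨ξ, u⟩, rfl⟩ _ ⟨⟨η, v⟩, rfl⟩
    have h₁ : B (F ξ) (v + A v) = 0 := hFU ξ _ (mem_U v)
    have h₂ : B (u + A u) (F η) = 0 := (hsymm _ _).trans (hFU η _ (mem_U u))
    have h₃ : B (u + A u) (v + A v) = 0 := by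
      simp only [map_add, LinearMap.add_apply, hW₁ u (hU₁ u.2) v (hU₁ v.2),
        hW₂ (A u) (hU₂ (A u).2) (A v) (hU₂ (A v).2), hsymm (A u) v, hA]
      linear_combination hω u v
    rw [hT, hT, map_add B, LinearMap.add_apply, map_add (B (F ξ)), map_add (B (u + A u)),
      hFF, h₁, h₂, h₃]
    simp
  · rw [Submodule.isCompl_iff_disjoint _ _ (by omega), Submodule.disjoint_def]
    rintro _ h ⟨x, rfl⟩
    rw [eq_zero₁ h, map_zero]
  · rw [Submodule.isCompl_iff_disjoint _ _ (by omega), Submodule.disjoint_def]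
    rintro _ h ⟨x, rfl⟩
    rw [eq_zero₂ h, map_zero]

end

theorem common_isotropic_complement_complex {V : Type*} [AddCommGroup V]
    [Module ℂ V] [FiniteDimensional ℂ V] (n : ℕ)
    (hdim : Module.finrank ℂ V = 2 * n)
    (B : V →ₗ[ℂ] V →ₗ[ℂ] ℂ)
    (hsymm : ∀ x y, B x y = B y x)
    (hnondeg : ∀ x, (∀ y, B x y = 0) → x = 0)
    (W₁ W₂ : Submodule ℂ V)
    (hW₁ : IsMaxIsotropic B W₁) (hW₂ : IsMaxIsotropic B W₂)
    (hpar : Module.finrank ℂ (W₁ ⊓ W₂ : Submodule ℂ V) % 2 = n % 2) :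
    ∃ H : Submodule ℂ V, IsMaxIsotropic B H ∧ IsCompl W₁ H ∧ IsCompl W₂ H := by
  obtain ⟨H, hH, h₁, h₂⟩ := exists_isIsotropic_isCompl_of_lagrangian hdim hsymm hnondeg hW₁.1 hW₂.1
    (fun _ => hW₂.mem_of_orthogonal hdim hsymm hnondeg) (hW₁.finrank_eq hdim hsymm hnondeg)
    (hW₂.finrank_eq hdim hsymm hnondeg) hpar
  exact ⟨H, hW₁.1.isMaxIsotropic_of_isCompl hnondeg hH h₁, h₁, h₂⟩
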